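/- In the hyperoctahedral group W of type C_{n+1} with simple reflections s_1,...,s_{n+1} (s_i = s_{t_i - t_{i+1}} for i ≤ n, s_{n+1} = s_{2t_{n+1}}), the Hecke product satisfies s_{2t_1} · s_{2t_1} = s_{t_1+t_2} · s_1, where s_{2t_1} = s_1 s_2 ⋯ s_n s_{n+1} s_n ⋯ s_2 s_1 and s_{t_1+t_2} is the reflection exchanging 1 ↔ \overline{2} and 2 ↔ \overline{1}. -/

import Mathlib

def bar (n : ℕ) (i : Fin (2*n+2)) : Fin (2*n+2) := ⟨2*n+1 - i, by have := i.isLt; omega⟩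

def IsSigned (n : ℕ) (w : Equiv.Perm (Fin (2*n+2))) : Prop :=
  ∀ i, w (bar n i) = bar n (w i)

def IsOddSymp (n : ℕ) (w : Equiv.Perm (Fin (2*n+2))) : Prop :=
  ∀ j : Fin (2*n+2), (j : ℕ) < n+1 → (w j : ℕ) ≠ 2*n+1

def sgen (n : ℕ) (i : Fin (n+1)) : Equiv.Perm (Fin (2*n+2)) :=
  if h : (i : ℕ) < n then
    (Equiv.swap ⟨i, by omega⟩ ⟨(i : ℕ)+1, by omega⟩) *
      (Equiv.swap ⟨2*n - i, by omega⟩ ⟨2*n+1 - i, by omega⟩)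
  else Equiv.swap ⟨n, by omega⟩ ⟨n+1, by omega⟩

noncomputable def len (n : ℕ) (w : Equiv.Perm (Fin (2*n+2))) : ℕ :=
  sInf {m | ∃ l : List (Fin (n+1)), l.length = m ∧ (l.map (sgen n)).prod = w}

def WP (n k : ℕ) : Subgroup (Equiv.Perm (Fin (2*n+2))) :=
  Subgroup.closure {x | ∃ i : Fin (n+1), (i : ℕ) ≠ k - 1 ∧ x = sgen n i}

noncomputable def IsMinRep (n k : ℕ) (w : Equiv.Perm (Fin (2*n+2))) : Prop :=
  ∀ p ∈ WP n k, len n w ≤ len n (w * p)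

noncomputable def cosetLen (n k : ℕ) (w : Equiv.Perm (Fin (2*n+2))) : ℕ :=
  sInf {m | ∃ p ∈ WP n k, len n (w * p) = m}

def s2t1 (n : ℕ) : Equiv.Perm (Fin (2*n+2)) := Equiv.swap ⟨0, by omega⟩ ⟨2*n+1, by omega⟩

def st1t2 (n : ℕ) : Equiv.Perm (Fin (2*n+2)) :=
  Equiv.swap ⟨0, by omega⟩ ⟨2*n, by omega⟩ * Equiv.swap ⟨1, by omega⟩ ⟨2*n+1, by omega⟩


theorem swap_cases {m : ℕ} (a b x : Fin m) :
    ((x : ℕ) = a ∧ (Equiv.swap a b x : ℕ) = b) ∨ ((x : ℕ) = b ∧ (Equiv.swap a b x : ℕ) = a) ∨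
      ((x : ℕ) ≠ a ∧ (x : ℕ) ≠ b ∧ (Equiv.swap a b x : ℕ) = x) := by
  by_cases h1 : x = a
  · subst h1; left; simp
  by_cases h2 : x = b
  · subst h2; right; left; simp
  right; right
  exact ⟨fun h => h1 (Fin.ext h), fun h => h2 (Fin.ext h),
    by rw [Equiv.swap_apply_of_ne_of_ne h1 h2]⟩

theorem sgen_cases (n : ℕ) (i : Fin (n+1)) (x : Fin (2*n+2)) :
    ((x : ℕ) = i ∧ (sgen n i x : ℕ) = i + 1) ∨ ((x : ℕ) = i + 1 ∧ (sgen n i x : ℕ) = i) ∨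
    ((x : ℕ) + i = 2*n ∧ (sgen n i x : ℕ) + i = 2*n+1) ∨
    ((x : ℕ) + i = 2*n+1 ∧ (sgen n i x : ℕ) + i = 2*n) ∨
    ((x : ℕ) ≠ i ∧ (x : ℕ) ≠ i + 1 ∧ (x : ℕ) + i ≠ 2*n ∧ (x : ℕ) + i ≠ 2*n+1 ∧
      (sgen n i x : ℕ) = x) := by
  have hi := i.isLt
  unfold sgen
  by_cases h : (i : ℕ) < n
  · rw [dif_pos h, Equiv.Perm.mul_apply]
    have h1 := swap_cases (⟨2*n - i, by omega⟩ : Fin (2*n+2)) ⟨2*n+1 - i, by omega⟩ x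
    have h2 := swap_cases (⟨i, by omega⟩ : Fin (2*n+2)) ⟨(i : ℕ)+1, by omega⟩
      (Equiv.swap (⟨2*n - i, by omega⟩ : Fin (2*n+2)) ⟨2*n+1 - i, by omega⟩ x)
    simp only at h1 h2
    omega
  · rw [dif_neg h]
    have h1 := swap_cases (⟨n, by omega⟩ : Fin (2*n+2)) ⟨n+1, by omega⟩ x
    simp only at h1
    omega

theorem sgen_val (n : ℕ) (i : Fin (n+1)) (x : Fin (2*n+2)) :
    (sgen n i x : ℕ) = if (x : ℕ) = i then (i : ℕ) + 1 else if (x : ℕ) = i + 1 then (i : ℕ)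
      else if (x : ℕ) = 2*n - i then 2*n+1-i else if (x : ℕ) = 2*n+1-i then 2*n-i else x := by
  have hi := i.isLt
  have := sgen_cases n i x
  split_ifs <;> omega

def posL (n : ℕ) (i : Fin (n+1)) : Fin (2*n+2) := ⟨i, by omega⟩
def posR (n : ℕ) (i : Fin (n+1)) : Fin (2*n+2) := ⟨i+1, by omega⟩

theorem sgen_signed (n : ℕ) (i : Fin (n+1)) : IsSigned n (sgen n i) := by
  intro x
  apply Fin.ext
  have hi := i.isLt
  have hx := x.isLt
  have h1 := sgen_cases n i x
  have h2 := sgen_cases n i (bar n x)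
  have h3 : (bar n x : ℕ) = 2*n+1 - x := rfl
  have h4 : (bar n (sgen n i x) : ℕ) = 2*n+1 - (sgen n i x : ℕ) := rfl
  omega

theorem signed_mul (n : ℕ) {a b : Equiv.Perm (Fin (2*n+2))} (ha : IsSigned n a)
    (hb : IsSigned n b) : IsSigned n (a * b) := by
  intro x
  simp only [Equiv.Perm.mul_apply, hb x, ha (b x)]

theorem sgen_sq (n : ℕ) (i : Fin (n+1)) : sgen n i * sgen n i = 1 := by
  ext x
  have hi := i.isLt
  have hx := x.isLt
  simp only [Equiv.Perm.mul_apply, Equiv.Perm.one_apply]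
  have h1 := sgen_cases n i x
  have h2 := sgen_cases n i (sgen n i x)
  omega

theorem prod_signed (n : ℕ) (l : List (Fin (n+1))) : IsSigned n (l.map (sgen n)).prod := by
  induction l with
  | nil => intro x; simp
  | cons a t ih => simpa using signed_mul n (sgen_signed n a) ih

theorem conj_lemma (n : ℕ) (u : Equiv.Perm (Fin (2*n+2))) (hu : IsSigned n u) (i a : Fin (n+1))
    (h1 : u (posL n i) < u (posR n i))
    (h2 : sgen n a (u (posR n i)) < sgen n a (u (posL n i))) :
    sgen n a * u = u * sgen n i := by
  have hi := i.isLt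
  have ha := a.isLt
  have key : ((u (posL n i) : ℕ) = a ∧ (u (posR n i) : ℕ) = a + 1) ∨
      ((u (posL n i) : ℕ) = 2*n - a ∧ (u (posR n i) : ℕ) = 2*n + 1 - a) := by
    rw [Fin.lt_def] at h1 h2
    have c1 := sgen_cases n a (u (posL n i))
    have c2 := sgen_cases n a (u (posR n i))
    have := (u (posL n i)).isLt
    have := (u (posR n i)).isLt
    rcases c1 with c1 | c1 | c1 | c1 | c1 <;> rcases c2 with c2 | c2 | c2 | c2 | c2 <;> omega
  have pL : (posL n i : ℕ) = i := rfl
  have pR : (posR n i : ℕ) = i + 1 := rfl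
  have bar_val : ∀ y : Fin (2*n+2), (bar n y : ℕ) = 2*n+1 - y := fun _ => rfl
  have bL : (u (bar n (posL n i)) : ℕ) = 2*n+1 - (u (posL n i) : ℕ) :=
    congrArg Fin.val (hu (posL n i))
  have bR : (u (bar n (posR n i)) : ℕ) = 2*n+1 - (u (posR n i) : ℕ) :=
    congrArg Fin.val (hu (posR n i))
  have sL : sgen n i (posL n i) = posR n i := by
    have := sgen_cases n i (posL n i)
    apply Fin.ext; omega
  have sR : sgen n i (posR n i) = posL n i := by
    have := sgen_cases n i (posR n i)
    apply Fin.ext; omega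
  have sbL : sgen n i (bar n (posL n i)) = bar n (posR n i) := by
    rw [sgen_signed n i, sL]
  have sbR : sgen n i (bar n (posR n i)) = bar n (posL n i) := by
    rw [sgen_signed n i, sR]
  ext x
  simp only [Equiv.Perm.mul_apply]
  have sa := sgen_cases n a (u x)
  by_cases c1 : x = posL n i
  · subst c1; rw [sL]; omega
  by_cases c2 : x = posR n i
  · subst c2; rw [sR]; omega
  by_cases c3 : x = bar n (posL n i)
  · subst c3; rw [sbL]; omega
  by_cases c4 : x = bar n (posR n i)
  · subst c4; rw [sbR]; omega
  have hsx : sgen n i x = x := by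
    have := sgen_cases n i x
    have := bar_val (posL n i)
    have := bar_val (posR n i)
    rw [Fin.ext_iff] at c1 c2 c3 c4
    apply Fin.ext; omega
  rw [hsx]
  have inj : ∀ y : Fin (2*n+2), x ≠ y → (u x : ℕ) ≠ u y := by
    intro y hy hxy
    exact hy (u.injective (Fin.ext hxy))
  have i1 := inj _ c1
  have i2 := inj _ c2
  have i3 := inj _ c3
  have i4 := inj _ c4
  rcases key with key | key <;> rcases sa with sa | sa | sa | sa | sa <;> omega

theorem exchange (n : ℕ) (i : Fin (n+1)) (l : List (Fin (n+1))) :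
    (l.map (sgen n)).prod (posR n i) < (l.map (sgen n)).prod (posL n i) →
    ∃ l' : List (Fin (n+1)), l'.length + 1 = l.length ∧
      (l'.map (sgen n)).prod = (l.map (sgen n)).prod * sgen n i := by
  induction l with
  | nil => intro h; simp [posL, posR, Fin.lt_def] at h
  | cons a t ih =>
    intro h
    rcases lt_trichotomy ((t.map (sgen n)).prod (posR n i)) ((t.map (sgen n)).prod (posL n i))
      with h1 | h1 | h1
    · obtain ⟨l', hl, hp⟩ := ih h1
      exact ⟨a :: l', by simp [hl], by simp [hp, mul_assoc]⟩
    · have := congrArg Fin.val (Equiv.injective _ h1)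
      simp [posL, posR] at this
    · refine ⟨t, by simp, ?_⟩
      simp only [List.map_cons, List.prod_cons, Equiv.Perm.mul_apply] at h ⊢
      rw [conj_lemma n _ (prod_signed n t) i a h1 h, mul_assoc, sgen_sq, mul_one]

def Gen (n : ℕ) (w : Equiv.Perm (Fin (2*n+2))) : Prop :=
  ∃ l : List (Fin (n+1)), (l.map (sgen n)).prod = w

theorem Gen.signed {n : ℕ} {w : Equiv.Perm (Fin (2*n+2))} (hw : Gen n w) : IsSigned n w := by
  obtain ⟨l, rfl⟩ := hw
  exact prod_signed n l

theorem gen_sgen (n : ℕ) (i : Fin (n+1)) : Gen n (sgen n i) := ⟨[i], by simp⟩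

theorem Gen.mul {n : ℕ} {a b : Equiv.Perm (Fin (2*n+2))} (ha : Gen n a) (hb : Gen n b) :
    Gen n (a * b) := by
  obtain ⟨l, rfl⟩ := ha
  obtain ⟨m, rfl⟩ := hb
  exact ⟨l ++ m, by simp⟩

theorem len_descent (n : ℕ) {w : Equiv.Perm (Fin (2*n+2))} (hw : Gen n w) (i : Fin (n+1))
    (h : w (posR n i) < w (posL n i)) : len n (w * sgen n i) < len n w := by
  have hne : {m | ∃ l : List (Fin (n+1)), l.length = m ∧ (l.map (sgen n)).prod = w}.Nonempty := by
    obtain ⟨l, hl⟩ := hw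
    exact ⟨_, l, rfl, hl⟩
  obtain ⟨l, hl, hp⟩ := Nat.sInf_mem hne
  obtain ⟨l', hl', hp'⟩ := exchange n i l (by rw [hp]; exact h)
  have : len n (w * sgen n i) ≤ l'.length := Nat.sInf_le ⟨l', rfl, by rw [hp', hp]⟩
  have h3 : l.length = len n w := hl
  omega

theorem len_ascent (n : ℕ) {w : Equiv.Perm (Fin (2*n+2))} (hw : Gen n w) (i : Fin (n+1))
    (h : w (posL n i) < w (posR n i)) : len n w < len n (w * sgen n i) := by
  have hL : sgen n i (posL n i) = posR n i := by
    apply Fin.ext; rw [sgen_val]; simp [posL, posR]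
  have hR : sgen n i (posR n i) = posL n i := by
    apply Fin.ext; rw [sgen_val]; simp [posL, posR]
  have := len_descent n (hw.mul (gen_sgen n i)) i
    (by simpa only [Equiv.Perm.mul_apply, hL, hR] using h)
  rwa [mul_assoc, sgen_sq, mul_one] at this

/-- The reflection exchanging position `k` and its bar. -/
def refl2 (n k : ℕ) (hk : k ≤ n) : Equiv.Perm (Fin (2*n+2)) :=
  Equiv.swap ⟨k, by omega⟩ ⟨2*n+1-k, by omega⟩

theorem refl2_cases (n k : ℕ) (hk : k ≤ n) (x : Fin (2*n+2)) :
    ((x : ℕ) = k ∧ (refl2 n k hk x : ℕ) + k = 2*n+1) ∨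
    ((x : ℕ) + k = 2*n+1 ∧ (refl2 n k hk x : ℕ) = k) ∨
    ((x : ℕ) ≠ k ∧ (x : ℕ) + k ≠ 2*n+1 ∧ (refl2 n k hk x : ℕ) = x) := by
  have h1 := swap_cases (⟨k, by omega⟩ : Fin (2*n+2)) ⟨2*n+1-k, by omega⟩ x
  unfold refl2
  simp only at h1
  omega

theorem refl2_last (n : ℕ) : refl2 n n le_rfl = sgen n ⟨n, by omega⟩ := by
  ext x
  have h1 := refl2_cases n n le_rfl x
  have h2 := sgen_cases n ⟨n, by omega⟩ x
  simp only at h2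
  omega

theorem refl2_step (n k : ℕ) (hk : k + 1 ≤ n) :
    refl2 n k (by omega) = sgen n ⟨k, by omega⟩ * refl2 n (k+1) hk * sgen n ⟨k, by omega⟩ := by
  ext x
  have hx := x.isLt
  simp only [Equiv.Perm.mul_apply]
  have h1 := refl2_cases n k (by omega) x
  have h2 := sgen_cases n ⟨k, by omega⟩ x
  have h3 := refl2_cases n (k+1) hk (sgen n ⟨k, by omega⟩ x)
  have h4 := sgen_cases n ⟨k, by omega⟩ (refl2 n (k+1) hk (sgen n ⟨k, by omega⟩ x))
  simp only at h2 h4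
  rcases h2 with h2 | h2 | h2 | h2 | h2 <;> rcases h3 with h3 | h3 | h3 <;> omega

theorem refl2_gen (n d : ℕ) : ∀ k (hk : k ≤ n), k + d = n → Gen n (refl2 n k hk) := by
  induction d with
  | zero =>
    intro k hk h
    obtain rfl : k = n := by omega
    rw [refl2_last]
    exact gen_sgen _ _
  | succ d ih =>
    intro k hk h
    rw [refl2_step n k (by omega)]
    exact ((gen_sgen _ _).mul (ih (k+1) (by omega) (by omega))).mul (gen_sgen _ _)

section
variable (n : ℕ)
    (h : Equiv.Perm (Fin (2*n+2)) → Equiv.Perm (Fin (2*n+2)) → Equiv.Perm (Fin (2*n+2)))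
    (hassoc : ∀ a b c, IsSigned n a → IsSigned n b → IsSigned n c →
      h (h a b) c = h a (h b c))
    (hsimp : ∀ w i, IsSigned n w →
      h w (sgen n i) = if len n w < len n (w * sgen n i) then w * sgen n i else w)

theorem h_asc (hsimp : ∀ w i, IsSigned n w →
      h w (sgen n i) = if len n w < len n (w * sgen n i) then w * sgen n i else w)
    {w : Equiv.Perm (Fin (2*n+2))} (hw : Gen n w) (i : Fin (n+1))
    (hlt : w (posL n i) < w (posR n i)) : h w (sgen n i) = w * sgen n i := by
  rw [hsimp w i hw.signed, if_pos (len_ascent n hw i hlt)]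

theorem h_desc (hsimp : ∀ w i, IsSigned n w →
      h w (sgen n i) = if len n w < len n (w * sgen n i) then w * sgen n i else w)
    {w : Equiv.Perm (Fin (2*n+2))} (hw : Gen n w) (i : Fin (n+1))
    (hlt : w (posR n i) < w (posL n i)) : h w (sgen n i) = w := by
  rw [hsimp w i hw.signed, if_neg (not_lt.mpr (len_descent n hw i hlt).le)]

def IncOn (k : ℕ) (w : Equiv.Perm (Fin (2*n+2))) : Prop :=
  ∀ x y : Fin (2*n+2), k ≤ (x : ℕ) → x < y → (y : ℕ) ≤ 2*n+1-k → w x < w y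

theorem h_factor (k : ℕ) (hk : k + 1 ≤ n)
    (hsimp : ∀ w i, IsSigned n w →
      h w (sgen n i) = if len n w < len n (w * sgen n i) then w * sgen n i else w)
    (ih : ∀ w, Gen n w → IncOn n (k+1) w → h w (refl2 n (k+1) hk) = w * refl2 n (k+1) hk) :
    refl2 n k (by omega) = h (h (sgen n ⟨k, by omega⟩) (refl2 n (k+1) hk)) (sgen n ⟨k, by omega⟩) := by
  rw [ih _ (gen_sgen _ _), h_asc n h hsimp, refl2_step n k hk]
  · exact (gen_sgen _ _).mul (refl2_gen n (n-(k+1)) _ _ (by omega))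
  · rw [Fin.lt_def]
    simp only [Equiv.Perm.mul_apply]
    have a1 := refl2_cases n (k+1) hk (posL n ⟨k, by omega⟩)
    have a2 := refl2_cases n (k+1) hk (posR n ⟨k, by omega⟩)
    have a3 := sgen_cases n ⟨k, by omega⟩ (refl2 n (k+1) hk (posL n ⟨k, by omega⟩))
    have a4 := sgen_cases n ⟨k, by omega⟩ (refl2 n (k+1) hk (posR n ⟨k, by omega⟩))
    have pL : (posL n ⟨k, by omega⟩ : ℕ) = k := rfl
    have pR : (posR n ⟨k, by omega⟩ : ℕ) = k + 1 := rfl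
    simp only at a3 a4
    omega
  · intro x y h1 h2 h3
    rw [Fin.lt_def] at *
    have a1 := sgen_cases n ⟨k, by omega⟩ x
    have a2 := sgen_cases n ⟨k, by omega⟩ y
    simp only at a1 a2
    omega

theorem h_refl2
    (hassoc : ∀ a b c, IsSigned n a → IsSigned n b → IsSigned n c →
      h (h a b) c = h a (h b c))
    (hclosed : ∀ a b, IsSigned n a → IsSigned n b → IsSigned n (h a b))
    (hsimp : ∀ w i, IsSigned n w →
      h w (sgen n i) = if len n w < len n (w * sgen n i) then w * sgen n i else w)
    (d : ℕ) : ∀ k (hk : k ≤ n), k + d = n → ∀ w, Gen n w → IncOn n k w →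
      h w (refl2 n k hk) = w * refl2 n k hk := by
  induction d with
  | zero =>
    intro k hk hd w hw hinc
    obtain rfl : k = n := by omega
    rw [refl2_last]
    apply h_asc _ h hsimp hw
    apply hinc
    · simp [posL]
    · simp [posL, posR, Fin.lt_def]
    · simp only [posR]; omega
  | succ d ih =>
    intro k hk hd w hw hinc
    have ih' := ih (k+1) (by omega) (by omega)
    have hg : Gen n (refl2 n (k+1) (by omega)) := refl2_gen n (n-(k+1)) _ _ (by omega)
    have hs := gen_sgen n ⟨k, by omega⟩
    have hsv := sgen_cases n ⟨k, by omega⟩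
    simp only at hsv
    conv_lhs => rw [h_factor n h k (by omega) hsimp ih']
    rw [← hassoc _ _ _ hw.signed (hclosed _ _ hs.signed hg.signed) hs.signed,
      ← hassoc _ _ _ hw.signed hs.signed hg.signed, h_asc n h hsimp hw, ih' _ (hw.mul hs),
      h_asc n h hsimp ((hw.mul hs).mul hg), refl2_step n k (by omega)]
    · simp only [mul_assoc]
    · simp only [Equiv.Perm.mul_apply]
      have a1 := refl2_cases n (k+1) (by omega) (posL n ⟨k, by omega⟩)
      have a2 := refl2_cases n (k+1) (by omega) (posR n ⟨k, by omega⟩)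
      have a3 := hsv (refl2 n (k+1) (by omega) (posL n ⟨k, by omega⟩))
      have a4 := hsv (refl2 n (k+1) (by omega) (posR n ⟨k, by omega⟩))
      have pL : (posL n ⟨k, by omega⟩ : ℕ) = k := rfl
      have pR : (posR n ⟨k, by omega⟩ : ℕ) = k + 1 := rfl
      apply hinc
      · omega
      · rw [Fin.lt_def]; omega
      · omega
    · intro x y h1 h2 h3
      rw [Fin.lt_def] at h2
      simp only [Equiv.Perm.mul_apply]
      have a1 := hsv x
      have a2 := hsv y
      apply hinc
      · omega
      · rw [Fin.lt_def]; omega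
      · omega
    · apply hinc
      · simp [posL]
      · simp [posL, posR, Fin.lt_def]
      · simp only [posR]; omega

end

theorem st1t2_cases (n : ℕ) (hn : 1 ≤ n) (x : Fin (2*n+2)) :
    ((x : ℕ) = 0 ∧ (st1t2 n x : ℕ) = 2*n) ∨ ((x : ℕ) = 1 ∧ (st1t2 n x : ℕ) = 2*n+1) ∨
    ((x : ℕ) = 2*n ∧ (st1t2 n x : ℕ) = 0) ∨ ((x : ℕ) = 2*n+1 ∧ (st1t2 n x : ℕ) = 1) ∨
    ((x : ℕ) ≠ 0 ∧ (x : ℕ) ≠ 1 ∧ (x : ℕ) ≠ 2*n ∧ (x : ℕ) ≠ 2*n+1 ∧ (st1t2 n x : ℕ) = x) := by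
  have h1 := swap_cases (⟨1, by omega⟩ : Fin (2*n+2)) ⟨2*n+1, by omega⟩ x
  have h2 := swap_cases (⟨0, by omega⟩ : Fin (2*n+2)) ⟨2*n, by omega⟩
    (Equiv.swap (⟨1, by omega⟩ : Fin (2*n+2)) ⟨2*n+1, by omega⟩ x)
  unfold st1t2
  rw [Equiv.Perm.mul_apply]
  simp only at h1 h2
  omega

theorem st1t2_eq (n : ℕ) (hn : 1 ≤ n) :
    st1t2 n = refl2 n 0 (by omega) * sgen n ⟨0, Nat.succ_pos n⟩ * refl2 n 0 (by omega) := by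
  ext x
  have hx := x.isLt
  simp only [Equiv.Perm.mul_apply]
  have h1 := st1t2_cases n hn x
  have h2 := refl2_cases n 0 (by omega) x
  have h3 := sgen_cases n ⟨0, by omega⟩ (refl2 n 0 (by omega) x)
  have h4 := refl2_cases n 0 (by omega) (sgen n ⟨0, by omega⟩ (refl2 n 0 (by omega) x))
  simp only at h3
  rcases h1 with h1 | h1 | h1 | h1 | h1 <;> rcases h2 with h2 | h2 | h2 <;> omega

/-- The Hecke product identity `s_{2t_1} · s_{2t_1} = s_{t_1+t_2} · s_1` in the
hyperoctahedral group of type `C_{n+1}`.  The Hecke product is formalized as any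
operation `h` which is associative (on signed permutations), has `1` as a unit,
preserves signed permutations, and satisfies the defining rule
`w · s_i = w s_i` if `ℓ(w s_i) > ℓ(w)`, and `w · s_i = w` otherwise. -/
theorem stmt1 (n : ℕ) (hn : 1 ≤ n)
    (h : Equiv.Perm (Fin (2*n+2)) → Equiv.Perm (Fin (2*n+2)) → Equiv.Perm (Fin (2*n+2)))
    (hclosed : ∀ a b, IsSigned n a → IsSigned n b → IsSigned n (h a b))
    (hassoc : ∀ a b c, IsSigned n a → IsSigned n b → IsSigned n c →
      h (h a b) c = h a (h b c))
    (hone : ∀ a, IsSigned n a → h a 1 = a)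
    (hsimp : ∀ w i, IsSigned n w →
      h w (sgen n i) = if len n w < len n (w * sgen n i) then w * sgen n i else w) :
    h (s2t1 n) (s2t1 n) = h (st1t2 n) (sgen n ⟨0, by omega⟩) := by
  have hS : s2t1 n = refl2 n 0 (by omega) := rfl
  have gS : Gen n (refl2 n 0 (by omega)) := refl2_gen n n 0 _ (by omega)
  have gT : Gen n (refl2 n 1 hn) := refl2_gen n (n-1) 1 _ (by omega)
  have gs := gen_sgen n ⟨0, by omega⟩
  have hT := h_refl2 n h hassoc hclosed hsimp (n-1) 1 hn (by omega)
  have hfac := h_factor n h 0 (by omega) hsimp hT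
  have gt : Gen n (st1t2 n) := by
    rw [st1t2_eq n hn]
    exact (gS.mul gs).mul gS
  have pL : (posL n ⟨0, by omega⟩ : ℕ) = 0 := rfl
  have pR : (posR n ⟨0, by omega⟩ : ℕ) = 1 := rfl
  have r0 := refl2_cases n 0 (by omega)
  have r1 := refl2_cases n 1 hn
  have e1 : h (refl2 n 0 (by omega)) (sgen n ⟨0, by omega⟩) = refl2 n 0 (by omega) := by
    apply h_desc n h hsimp gS
    have a1 := r0 (posL n ⟨0, by omega⟩)
    have a2 := r0 (posR n ⟨0, by omega⟩)
    rw [Fin.lt_def]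
    omega
  have e2 : h (refl2 n 0 (by omega)) (refl2 n 1 hn) = refl2 n 0 (by omega) * refl2 n 1 hn := by
    apply hT _ gS
    intro x y h1 h2 h3
    rw [Fin.lt_def] at *
    have a1 := r0 x
    have a2 := r0 y
    omega
  have e3 : h (refl2 n 0 (by omega) * refl2 n 1 hn) (sgen n ⟨0, by omega⟩)
      = refl2 n 0 (by omega) * refl2 n 1 hn := by
    apply h_desc n h hsimp (gS.mul gT)
    simp only [Equiv.Perm.mul_apply]
    have a1 := r1 (posL n ⟨0, by omega⟩)
    have a2 := r1 (posR n ⟨0, by omega⟩)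
    have a3 := r0 (refl2 n 1 hn (posL n ⟨0, by omega⟩))
    have a4 := r0 (refl2 n 1 hn (posR n ⟨0, by omega⟩))
    rw [Fin.lt_def]
    omega
  have e4 : h (st1t2 n) (sgen n ⟨0, by omega⟩) = st1t2 n * sgen n ⟨0, by omega⟩ := by
    apply h_asc n h hsimp gt
    have a1 := st1t2_cases n hn (posL n ⟨0, by omega⟩)
    have a2 := st1t2_cases n hn (posR n ⟨0, by omega⟩)
    rw [Fin.lt_def]
    omega
  rw [hS]
  have e5 : h (refl2 n 0 (by omega)) (refl2 n 0 (by omega)) =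
      refl2 n 0 (by omega) * refl2 n 1 hn := by
    conv_lhs => arg 2; rw [hfac]
    rw [← hassoc _ _ _ gS.signed (hclosed _ _ gs.signed gT.signed) gs.signed,
      ← hassoc _ _ _ gS.signed gs.signed gT.signed, e1, e2, e3]
  rw [e5, e4]
  ext x
  have hx := x.isLt
  simp only [Equiv.Perm.mul_apply]
  have a1 := r1 x
  have a2 := r0 (refl2 n 1 hn x)
  have a3 := sgen_cases n ⟨0, by omega⟩ x
  have a4 := st1t2_cases n hn (sgen n ⟨0, by omega⟩ x)
  simp only at a3
  rcases a3 with a3 | a3 | a3 | a3 | a3 <;> rcases a1 with a1 | a1 | a1 <;> omega
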